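/- C¹ regularity of the odd-even extension: Let f : (0, π/2) → ℝ be twice differentiable with f' extending continuously to [0, π/2] and f'(0⁺) = 0. Let f^e be the 2π-periodic odd-even extension of f, defined by f^e(x) = f(x) for x ∈ (0, π/2], f^e(x) = 2f((π/2)⁻) − f(π − x) for x ∈ (π/2, π], f^e(x) = f^e(2π − x) for x ∈ (π, 2π), and extended 2π-periodically to ℝ. Then f^e is differentiable at every point of ℝ, its derivative is the continuous 2π-periodic function given on (0, 2π) by (f^e)'(x) = f'(x) for x ∈ (0, π/2], (f^e)'(x) = f'(π − x) for x ∈ (π/2, π], (f^e)'(x) = −f'(x − π) for x ∈ (π, 3π/2], and (f^e)'(x) = −f'(2π − x) for x ∈ (3π/2, 2π), and (f^e)'(0) = 0. -/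

import Mathlib

open Real MeasureTheory

noncomputable section

/-- Equispaced nodes `x_j = jπ/N`. -/
def node (N : ℕ) (j : ℕ) : ℝ := j * Real.pi / N

/-- The trigonometric polynomial `x ↦ Σ_{k=-N}^{N-1} c_k e^{ikx}`. -/
def trigPoly (N : ℕ) (c : ℤ → ℂ) : ℝ → ℂ := fun x =>
  ∑ k ∈ Finset.Icc (-(N : ℤ)) ((N : ℤ) - 1), c k * Complex.exp (Complex.I * k * x)

/-- Membership in the space `S_N` of trigonometric polynomials of degree `N`. -/
def memSN (N : ℕ) (v : ℝ → ℂ) : Prop := ∃ c : ℤ → ℂ, v = trigPoly N c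

/-- Discrete Fourier transform coefficients of `u` at the `2N` equispaced nodes. -/
def dftCoeff (N : ℕ) (u : ℝ → ℂ) (k : ℤ) : ℂ :=
  (1 / (2 * N : ℂ)) *
    ∑ j ∈ Finset.range (2 * N), u (node N j) * Complex.exp (-(Complex.I * k * node N j))

/-- The trigonometric interpolant `I_N(u) ∈ S_N` of `u` at the equispaced nodes. -/
def interp (N : ℕ) (u : ℝ → ℂ) : ℝ → ℂ := trigPoly N (dftCoeff N u)

/-- The `L²(0, 2π)` norm. -/
def l2norm {E : Type*} [NormedAddCommGroup E] (v : ℝ → E) : ℝ :=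
  Real.sqrt (∫ x in (0:ℝ)..(2 * Real.pi), ‖v x‖ ^ 2)

/-- The sup norm over `[0, 2π]`. -/
def supNorm {E : Type*} [NormedAddCommGroup E] (v : ℝ → E) : ℝ :=
  ⨆ x : Set.Icc (0:ℝ) (2 * Real.pi), ‖v x.1‖

/-- `u` has the (pointwise convergent) Fourier expansion with coefficients `c`. -/
def hasFourierCoeffs (u : ℝ → ℂ) (c : ℤ → ℂ) : Prop :=
  ∀ x : ℝ, HasSum (fun k : ℤ => c k * Complex.exp (Complex.I * k * x)) (u x)

/-- Membership in the periodic Sobolev space `H^m_p`, expressed via Fourier coefficients. -/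
def inHp (m : ℕ) (c : ℤ → ℂ) : Prop :=
  Summable fun k : ℤ => (|k| : ℝ) ^ (2 * m) * ‖c k‖ ^ 2

/-- `‖∂^m u/∂x^m‖ = (2π Σ_k |k|^{2m}|c_k|²)^{1/2}` for `u` with Fourier coefficients `c`. -/
def sobNorm (m : ℕ) (c : ℤ → ℂ) : ℝ :=
  Real.sqrt (2 * Real.pi * ∑' k : ℤ, (|k| : ℝ) ^ (2 * m) * ‖c k‖ ^ 2)

/-- Core of the odd-even extension on `[0, π]`: equals `f` on `[0, π/2]` and equals
`2f((π/2)⁻) − f(π − y)` on `(π/2, π]`. -/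
def oeCore (f : ℝ → ℝ) (y : ℝ) : ℝ :=
  if y ≤ Real.pi / 2 then f y else 2 * f (Real.pi / 2) - f (Real.pi - y)

/-- The `2π`-periodic odd-even extension `f^e` of `f : (0, π/2) → ℝ`:
`f^e = f` on `(0, π/2]`, `f^e(x) = 2f((π/2)⁻) − f(π − x)` on `(π/2, π]`,
`f^e(x) = f^e(2π − x)` on `(π, 2π)`, extended `2π`-periodically. -/
def oddEvenExt (f : ℝ → ℝ) (x : ℝ) : ℝ :=
  let y := x - 2 * Real.pi * (⌊x / (2 * Real.pi)⌋ : ℤ)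
  if y ≤ Real.pi then oeCore f y else oeCore f (2 * Real.pi - y)

/-- The claimed piecewise derivative of the odd-even extension, built from a
continuous extension `g` of `f'` to `[0, π/2]`: on `(0, 2π)` it equals `g(x)` for
`x ∈ (0, π/2]`, `g(π − x)` for `x ∈ (π/2, π]`, `−g(x − π)` for `x ∈ (π, 3π/2]`,
`−g(2π − x)` for `x ∈ (3π/2, 2π)`, with value `g(0) = 0` at `0`,
extended `2π`-periodically. -/
def oeDeriv (g : ℝ → ℝ) (x : ℝ) : ℝ :=
  let y := x - 2 * Real.pi * (⌊x / (2 * Real.pi)⌋ : ℤ)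
  if y ≤ Real.pi / 2 then g y
  else if y ≤ Real.pi then g (Real.pi - y)
  else if y ≤ 3 * Real.pi / 2 then -g (y - Real.pi)
  else -g (2 * Real.pi - y)

/-- The odd extension to `ℝ` of a function `g` on `[0, π/2]` with `g 0 = 0`, constant outside
`[-π/2, π/2]`. -/
def oddIccExtend (g : ℝ → ℝ) (u : ℝ) : ℝ :=
  Set.IccExtend Real.pi_div_two_pos.le ((Set.Icc (0:ℝ) (Real.pi / 2)).domRestrict g) u -
    Set.IccExtend Real.pi_div_two_pos.le ((Set.Icc (0:ℝ) (Real.pi / 2)).domRestrict g) (-u)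

lemma continuous_oddIccExtend {g : ℝ → ℝ} (hg : ContinuousOn g (Set.Icc (0:ℝ) (Real.pi / 2))) :
    Continuous (oddIccExtend g) := by
  have h := hg.domRestrict.Icc_extend' (h := Real.pi_div_two_pos.le)
  exact h.sub (h.comp continuous_neg)

lemma oddIccExtend_neg (g : ℝ → ℝ) (u : ℝ) : oddIccExtend g (-u) = -oddIccExtend g u := by
  simp [oddIccExtend]

lemma oddIccExtend_of_mem {g : ℝ → ℝ} (hg0 : g 0 = 0) {u : ℝ}
    (hu : u ∈ Set.Icc (0:ℝ) (Real.pi / 2)) : oddIccExtend g u = g u := by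
  rw [oddIccExtend, Set.IccExtend_of_mem _ _ hu,
    Set.IccExtend_of_le_left _ _ (neg_nonpos.mpr hu.1)]
  change g u - g 0 = g u
  rw [hg0, sub_zero]

/-- Reduction of `x` modulo `2π` lands in `[0, 2π)`. -/
lemma sub_two_pi_mul_floor_mem_Ico (x : ℝ) :
    x - 2 * Real.pi * (⌊x / (2 * Real.pi)⌋ : ℤ) ∈ Set.Ico 0 (2 * Real.pi) := by
  have hp := Real.two_pi_pos
  have h1 := (le_div_iff₀ hp).mp (Int.floor_le (x / (2 * Real.pi)))
  have h2 := (div_lt_iff₀ hp).mp (Int.lt_floor_add_one (x / (2 * Real.pi)))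
  constructor <;> linarith

lemma oeDeriv_eq_oddIccExtend {g : ℝ → ℝ} (hg0 : g 0 = 0) (x : ℝ) :
    oeDeriv g x = oddIccExtend g (Real.arcsin (Real.sin x)) := by
  obtain ⟨h0, h1⟩ := sub_two_pi_mul_floor_mem_Ico x
  have hs : Real.sin x = Real.sin (x - 2 * Real.pi * (⌊x / (2 * Real.pi)⌋ : ℤ)) := by
    rw [mul_comm (2 * Real.pi), Real.sin_sub_int_mul_two_pi]
  rw [hs]
  unfold oeDeriv
  generalize x - 2 * Real.pi * (⌊x / (2 * Real.pi)⌋ : ℤ) = y at h0 h1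
  have hp := Real.pi_pos
  dsimp only
  split_ifs with h2 h3 h4
  · rw [Real.arcsin_sin (by linarith) h2, oddIccExtend_of_mem hg0 ⟨h0, h2⟩]
  · rw [← Real.sin_pi_sub, Real.arcsin_sin (by linarith) (by linarith),
      oddIccExtend_of_mem hg0 ⟨by linarith, by linarith⟩]
  · rw [← Real.sin_pi_sub, Real.arcsin_sin (by linarith) (by linarith), ← neg_sub y,
      oddIccExtend_neg, oddIccExtend_of_mem hg0 ⟨by linarith, by linarith⟩]
  · rw [← Real.sin_sub_two_pi, Real.arcsin_sin (by linarith) (by linarith),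
      ← neg_sub (2 * Real.pi), oddIccExtend_neg,
      oddIccExtend_of_mem hg0 ⟨by linarith, by linarith⟩]

/-- A function with the symmetries of the odd-even extension that agrees with `f` on `[0, π/2]`
is the odd-even extension of `f`. -/
lemma oddEvenExt_eq_of_symm {f F : ℝ → ℝ} (heq : Set.EqOn F f (Set.Icc (0:ℝ) (Real.pi / 2)))
    (hrefl : ∀ x, F (Real.pi - x) = 2 * F (Real.pi / 2) - F x) (heven : ∀ x, F (-x) = F x)
    (hper : Function.Periodic F (2 * Real.pi)) : oddEvenExt f = F := by
  have hp := Real.pi_pos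
  have hcore : ∀ y, 0 ≤ y → y ≤ Real.pi → oeCore f y = F y := by
    intro y h0 h1
    unfold oeCore
    split_ifs with h2
    · exact (heq ⟨h0, h2⟩).symm
    · rw [← heq ⟨by linarith, le_rfl⟩, ← heq ⟨by linarith, by linarith⟩, hrefl]
      ring
  funext x
  obtain ⟨h0, h1⟩ := sub_two_pi_mul_floor_mem_Ico x
  have hx : F x = F (x - 2 * Real.pi * (⌊x / (2 * Real.pi)⌋ : ℤ)) := by
    rw [mul_comm (2 * Real.pi), hper.sub_int_mul_eq]
  rw [hx]
  unfold oddEvenExt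
  generalize x - 2 * Real.pi * (⌊x / (2 * Real.pi)⌋ : ℤ) = y at h0 h1
  dsimp only
  split_ifs with h2
  · exact hcore y h0 h2
  · rw [hcore _ (by linarith) (by linarith), hper.sub_eq', heven]

/-- Symmetries of a derivative under `x ↦ π - x` and `x ↦ -x` integrate to a primitive. -/
lemma symm_of_hasDerivAt {F G : ℝ → ℝ} (hF : ∀ x, HasDerivAt F (G x) x)
    (hrefl : ∀ x, G (Real.pi - x) = G x) (hodd : ∀ x, G (-x) = -G x) :
    (∀ x, F (Real.pi - x) = 2 * F (Real.pi / 2) - F x) ∧ (∀ x, F (-x) = F x) ∧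
      Function.Periodic F (2 * Real.pi) := by
  have h1 : ∀ x, F (Real.pi - x) = 2 * F (Real.pi / 2) - F x := by
    intro x
    have hd : ∀ y, HasDerivAt (fun y => F (Real.pi - y) + F y) 0 y := fun y => by
      simpa [hrefl] using ((hF (Real.pi - y)).comp_const_sub Real.pi y).fun_add (hF y)
    have h := is_const_of_deriv_eq_zero (fun y => (hd y).differentiableAt)
      (fun y => (hd y).deriv) x (Real.pi / 2)
    simp only [sub_half] at h
    linarith
  have h2 : ∀ x, F (-x) = F x := by
    intro x
    have hd : ∀ y, HasDerivAt (fun y => F (-y) - F y) 0 y := fun y => by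
      simpa [hodd] using (HasDerivAt.comp_const_sub 0 y (hF (0 - y))).fun_sub (hF y)
    have h := is_const_of_deriv_eq_zero (fun y => (hd y).differentiableAt)
      (fun y => (hd y).deriv) x 0
    simp only [neg_zero, sub_self] at h
    linarith
  refine ⟨h1, h2, fun x => ?_⟩
  have e1 := h1 (-x - Real.pi)
  have e2 := h1 (-x)
  rw [show Real.pi - (-x - Real.pi) = x + 2 * Real.pi by ring,
    show -x - Real.pi = -(Real.pi - -x) by ring, h2 (Real.pi - -x)] at e1
  linarith [h2 x]

/-- C¹ regularity of the odd-even extension. -/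
theorem oddEvenExt_C1
    (f : ℝ → ℝ)
    (hf1 : ∀ x ∈ Set.Ioo (0:ℝ) (Real.pi / 2), DifferentiableAt ℝ f x)
    (hf2 : ∀ x ∈ Set.Ioo (0:ℝ) (Real.pi / 2), DifferentiableAt ℝ (deriv f) x)
    (hfc : ContinuousOn f (Set.Icc (0:ℝ) (Real.pi / 2)))
    -- g is the continuous extension of f' to [0, π/2], with f'(0⁺) = g 0 = 0:
    (g : ℝ → ℝ) (hg : ContinuousOn g (Set.Icc (0:ℝ) (Real.pi / 2)))
    (hgf : ∀ x ∈ Set.Ioo (0:ℝ) (Real.pi / 2), g x = deriv f x)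
    (hg0 : g 0 = 0) :
    (∀ x : ℝ, HasDerivAt (oddEvenExt f) (oeDeriv g x) x) ∧
    Continuous (oeDeriv g) ∧
    Function.Periodic (oeDeriv g) (2 * Real.pi) ∧
    oeDeriv g 0 = 0 := by
  have hG : oeDeriv g = fun x => oddIccExtend g (Real.arcsin (Real.sin x)) :=
    funext (oeDeriv_eq_oddIccExtend hg0)
  have hcont : Continuous (oeDeriv g) := by
    rw [hG]
    exact (continuous_oddIccExtend hg).comp (Real.continuous_arcsin.comp Real.continuous_sin)
  have hEq : Set.EqOn (oeDeriv g) g (Set.Icc (0:ℝ) (Real.pi / 2)) := fun x hx => by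
    rw [hG]
    dsimp only
    rw [Real.arcsin_sin (by linarith [hx.1, Real.pi_pos]) hx.2, oddIccExtend_of_mem hg0 hx]
  refine ⟨?_, hcont, fun x => by simp [hG],
    (hEq ⟨le_rfl, Real.pi_div_two_pos.le⟩).trans hg0⟩
  set F : ℝ → ℝ := fun x => f 0 + ∫ t in (0:ℝ)..x, oeDeriv g t with hFdef
  have hF : ∀ x, HasDerivAt F (oeDeriv g x) x := fun x =>
    (hcont.integral_hasStrictDerivAt 0 x).hasDerivAt.const_add (f 0)
  have hFf : Set.EqOn F f (Set.Icc (0:ℝ) (Real.pi / 2)) := fun x hx => by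
    have h := intervalIntegral.integral_eq_sub_of_hasDerivAt_of_le hx.1
      (hfc.mono (Set.Icc_subset_Icc_right hx.2))
      (fun t ht => by
        have ht' : t ∈ Set.Ioo (0:ℝ) (Real.pi / 2) := ⟨ht.1, ht.2.trans_le hx.2⟩
        rw [hEq (Set.Ioo_subset_Icc_self ht'), hgf t ht']
        exact (hf1 t ht').hasDerivAt)
      (hcont.intervalIntegrable 0 x)
    simp only [hFdef, h]
    ring
  obtain ⟨h1, h2, h3⟩ := symm_of_hasDerivAt hF (fun x => by simp [hG])
    (fun x => by simp [hG, oddIccExtend_neg])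
  rw [oddEvenExt_eq_of_symm hFf h1 h2 h3]
  exact hF

end
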